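/- arXiv:math/9807083 — 2 statements merged into one kernel-verified Lean document; each statement's English description precedes it below -/
import Mathlib

section
/- Under the elliptic projective Lelieuvre relations, at every point p ∈ ℝ² one has f·⟨f_x,ν_x⟩ = [ν,ν_x,ν_y] = f·⟨f_y,ν_y⟩, ⟨f_x,ν_x⟩² = det(ν,ν_x,ν_y,ν_{xx}), ⟨f_y,ν_y⟩² = det(ν,ν_x,ν_y,ν_{yy}), and det(ν,ν_x,ν_y,ν_{xy}) = 0. -/
noncomputable section

/-- Euclidean pairing on `ℝ⁴`. -/
def dot4 (a b : Fin 4 → ℝ) : ℝ := ∑ i, a i * b i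

/-- Determinant of the 4×4 matrix with rows `a, b, c, d`. -/
def det4 (a b c d : Fin 4 → ℝ) : ℝ := Matrix.det (Matrix.of ![a, b, c, d])

/-- Partial derivative in the first (`x`) variable. -/
def dx (g : ℝ × ℝ → Fin 4 → ℝ) : ℝ × ℝ → Fin 4 → ℝ := fun p => fderiv ℝ g p (1, 0)

/-- Partial derivative in the second (`y`) variable. -/
def dy (g : ℝ × ℝ → Fin 4 → ℝ) : ℝ × ℝ → Fin 4 → ℝ := fun p => fderiv ℝ g p (0, 1)

theorem dot4_comm (a b : Fin 4 → ℝ) : dot4 a b = dot4 b a := by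
  simp only [dot4, mul_comm]

theorem eq_of_forall_dot4_eq {a b : Fin 4 → ℝ} (h : ∀ w, dot4 w a = dot4 w b) : a = b := by
  ext i
  simpa [dot4, Pi.single_apply] using h (Pi.single i 1)

theorem dot4_smul (w a : Fin 4 → ℝ) (c : ℝ) : dot4 w (c • a) = dot4 w a * c := by
  simp only [dot4, Finset.sum_mul, Pi.smul_apply, smul_eq_mul]
  exact Finset.sum_congr rfl fun i _ => by ring

theorem det4_expand (a b c d : Fin 4 → ℝ) :
    det4 a b c d =
      a 0 * (b 1 * (c 2 * d 3 - c 3 * d 2) - b 2 * (c 1 * d 3 - c 3 * d 1)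
        + b 3 * (c 1 * d 2 - c 2 * d 1))
      - a 1 * (b 0 * (c 2 * d 3 - c 3 * d 2) - b 2 * (c 0 * d 3 - c 3 * d 0)
        + b 3 * (c 0 * d 2 - c 2 * d 0))
      + a 2 * (b 0 * (c 1 * d 3 - c 3 * d 1) - b 1 * (c 0 * d 3 - c 3 * d 0)
        + b 3 * (c 0 * d 1 - c 1 * d 0))
      - a 3 * (b 0 * (c 1 * d 2 - c 2 * d 1) - b 1 * (c 0 * d 2 - c 2 * d 0)
        + b 2 * (c 0 * d 1 - c 1 * d 0)) := by
  simp [det4, Matrix.det_succ_row_zero, Fin.sum_univ_succ, Fin.succAbove]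
  ring

/-- Product rule for an identically vanishing pairing. -/
theorem dot4_fderiv_add_eq_zero {f g : ℝ × ℝ → Fin 4 → ℝ} (hf : Differentiable ℝ f)
    (hg : Differentiable ℝ g) (h : ∀ p, dot4 (f p) (g p) = 0) (p v : ℝ × ℝ) :
    dot4 (fderiv ℝ f p v) (g p) + dot4 (f p) (fderiv ℝ g p v) = 0 := by
  have hd : HasFDerivAt (fun q => ∑ i, f q i * g q i) _ p :=
    HasFDerivAt.fun_sum fun i _ =>
      (hasFDerivAt_pi'.1 (hf p).hasFDerivAt i).mul (hasFDerivAt_pi'.1 (hg p).hasFDerivAt i)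
  have h0 : (fun q => ∑ i, f q i * g q i) = fun _ => 0 := funext h
  rw [h0] at hd
  have hv := DFunLike.congr_fun (hd.unique (hasFDerivAt_const 0 p)) v
  simp only [dot4, ← Finset.sum_add_distrib]
  simpa [mul_comm, add_comm] using hv

theorem differentiable_fderiv_apply {g : ℝ × ℝ → Fin 4 → ℝ} (hg : ContDiff ℝ (⊤ : ℕ∞) g)
    (v : ℝ × ℝ) : Differentiable ℝ fun p => fderiv ℝ g p v := by
  have h : ContDiff ℝ 1 (fderiv ℝ g) := hg.fderiv_right (by norm_cast)
  exact (h.differentiable (by norm_num)).clm_apply (differentiable_const v)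

theorem eq_zero_of_forall_dot4_mul_eq_zero {a : Fin 4 → ℝ} (ha : a ≠ 0) {c : ℝ}
    (h : ∀ w, dot4 w a * c = 0) : c = 0 := by
  by_contra hc
  exact ha (eq_of_forall_dot4_eq fun w => by
    simpa [dot4] using (mul_eq_zero.1 (h w)).resolve_right hc)

theorem stmt8 (f ν : ℝ × ℝ → Fin 4 → ℝ)
    (hsf : ContDiff ℝ (⊤ : ℕ∞) f) (hsν : ContDiff ℝ (⊤ : ℕ∞) ν)
    (hpair : ∀ p, dot4 (f p) (ν p) = 0)
    (hLx : ∀ p, ∀ w z : Fin 4 → ℝ,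
      dot4 w (f p) * dot4 z (dx f p) - dot4 z (f p) * dot4 w (dx f p)
        = - det4 w z (ν p) (dy ν p))
    (hLy : ∀ p, ∀ w z : Fin 4 → ℝ,
      dot4 w (f p) * dot4 z (dy f p) - dot4 z (f p) * dot4 w (dy f p)
        = det4 w z (ν p) (dx ν p))
    (hf0 : ∀ p, f p ≠ 0)
    (tr : (Fin 4 → ℝ) → (Fin 4 → ℝ) → (Fin 4 → ℝ) → (Fin 4 → ℝ))
    (htr : ∀ w a b c : Fin 4 → ℝ, dot4 w (tr a b c) = det4 w a b c) :
    ∀ p : ℝ × ℝ,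
      dot4 (dx f p) (dx ν p) • f p = tr (ν p) (dx ν p) (dy ν p) ∧
      dot4 (dy f p) (dy ν p) • f p = tr (ν p) (dx ν p) (dy ν p) ∧
      (dot4 (dx f p) (dx ν p)) ^ 2 = det4 (ν p) (dx ν p) (dy ν p) (dx (dx ν) p) ∧
      (dot4 (dy f p) (dy ν p)) ^ 2 = det4 (ν p) (dx ν p) (dy ν p) (dy (dy ν) p) ∧
      det4 (ν p) (dx ν p) (dy ν p) (dy (dx ν) p) = 0 := by
  have hdf : Differentiable ℝ f := hsf.differentiable (by norm_num)
  have hdν : Differentiable ℝ ν := hsν.differentiable (by norm_num)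
  have hνf : ∀ p, dot4 (ν p) (f p) = 0 := fun p => by rw [dot4_comm, hpair]
  have hfxν : ∀ p, dot4 (ν p) (dx f p) = 0 := fun p =>
    eq_zero_of_forall_dot4_mul_eq_zero (hf0 p) fun w => by
      have h := hLx p w (ν p)
      rw [hνf, det4_expand] at h
      linear_combination h
  have hfyν : ∀ p, dot4 (ν p) (dy f p) = 0 := fun p =>
    eq_zero_of_forall_dot4_mul_eq_zero (hf0 p) fun w => by
      have h := hLy p w (ν p)
      rw [hνf, det4_expand] at h
      linear_combination h
  have hfνx : ∀ p, dot4 (f p) (dx ν p) = 0 := fun p => by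
    have h : dot4 (dx f p) (ν p) + dot4 (f p) (dx ν p) = 0 :=
      dot4_fderiv_add_eq_zero hdf hdν hpair p (1, 0)
    rwa [dot4_comm, hfxν, zero_add] at h
  have hfνy : ∀ p, dot4 (f p) (dy ν p) = 0 := fun p => by
    have h : dot4 (dy f p) (ν p) + dot4 (f p) (dy ν p) = 0 :=
      dot4_fderiv_add_eq_zero hdf hdν hpair p (0, 1)
    rwa [dot4_comm, hfyν, zero_add] at h
  have hfyνx : ∀ p, dot4 (dx ν p) (dy f p) = 0 := fun p =>
    eq_zero_of_forall_dot4_mul_eq_zero (hf0 p) fun w => by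
      have h := hLy p w (dx ν p)
      rw [dot4_comm (dx ν p) (f p), hfνx, det4_expand] at h
      linear_combination h
  intro p
  have hA : ∀ w, dot4 w (f p) * dot4 (dx f p) (dx ν p) = det4 w (ν p) (dx ν p) (dy ν p) :=
    fun w => by
      have h := hLx p w (dx ν p)
      rw [dot4_comm (dx ν p) (f p), hfνx, dot4_comm (dx ν p)] at h
      rw [det4_expand] at h ⊢
      linear_combination h
  have hB : ∀ w, dot4 w (f p) * dot4 (dy f p) (dy ν p) = det4 w (ν p) (dx ν p) (dy ν p) :=
    fun w => by
      have h := hLy p w (dy ν p)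
      rw [dot4_comm (dy ν p) (f p), hfνy, dot4_comm (dy ν p)] at h
      rw [det4_expand] at h ⊢
      linear_combination h
  have hrot : ∀ w, det4 (ν p) (dx ν p) (dy ν p) w = -det4 w (ν p) (dx ν p) (dy ν p) :=
    fun w => by
      simp only [det4_expand]
      ring
  have hxx : dot4 (dx f p) (dx ν p) + dot4 (f p) (dx (dx ν) p) = 0 :=
    dot4_fderiv_add_eq_zero hdf (differentiable_fderiv_apply hsν _) hfνx p (1, 0)
  have hyy : dot4 (dy f p) (dy ν p) + dot4 (f p) (dy (dy ν) p) = 0 :=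
    dot4_fderiv_add_eq_zero hdf (differentiable_fderiv_apply hsν _) hfνy p (0, 1)
  have hxy : dot4 (dy f p) (dx ν p) + dot4 (f p) (dy (dx ν) p) = 0 :=
    dot4_fderiv_add_eq_zero hdf (differentiable_fderiv_apply hsν _) hfνx p (0, 1)
  rw [dot4_comm, hfyνx, zero_add] at hxy
  refine ⟨eq_of_forall_dot4_eq fun w => ?_, eq_of_forall_dot4_eq fun w => ?_, ?_, ?_, ?_⟩
  · rw [htr, dot4_smul, hA]
  · rw [htr, dot4_smul, hB]
  · rw [hrot, ← hA, dot4_comm (dx (dx ν) p)]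
    linear_combination dot4 (dx f p) (dx ν p) * hxx
  · rw [hrot, ← hB, dot4_comm (dy (dy ν) p)]
    linear_combination dot4 (dy f p) (dy ν p) * hyy
  · rw [hrot, ← hA, dot4_comm (dy (dx ν) p), hxy, zero_mul, neg_zero]
end
end

section
/- Under the elliptic projective Lelieuvre relations, det(ν,ν_x,ν_y,ν_{xx}) = det(ν,ν_x,ν_y,ν_{yy}) at every point, and if at a point p ∈ ℝ² one has det(ν,ν_x,ν_y,ν_{xx})(p) > 0 and ⟨f_x,ν_x⟩(p) > 0, then f(p) = [ν,ν_x,ν_y](p) / √(det(ν,ν_x,ν_y,ν_{xx})(p)) = [ν,ν_x,ν_y](p) / √(det(ν,ν_x,ν_y,ν_{yy})(p)). -/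
noncomputable section

theorem dot4_self_ne_zero {a : Fin 4 → ℝ} (ha : a ≠ 0) : dot4 a a ≠ 0 := by
  intro h
  apply ha
  have h' := (Finset.sum_eq_zero_iff_of_nonneg fun i _ => mul_self_nonneg (a i)).1 h
  funext i
  exact mul_self_eq_zero.1 (h' i (Finset.mem_univ i))

theorem dot4_single (i : Fin 4) (b : Fin 4 → ℝ) : dot4 (Pi.single i 1) b = b i := by
  simp [dot4, Pi.single_apply]

theorem det4_eq_zero_of_two_eq_three (w a b : Fin 4 → ℝ) : det4 w a a b = 0 :=
  Matrix.det_zero_of_row_eq (i := 1) (j := 2) (by decide) rfl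

theorem det4_swap (w a b c : Fin 4 → ℝ) : det4 w b a c = - det4 w a b c := by
  simp [det4, Matrix.det_succ_row_zero, Fin.sum_univ_succ, Fin.succAbove]
  ring

theorem det4_rotate_last (w a b c : Fin 4 → ℝ) : det4 w c a b = det4 w a b c := by
  simp [det4, Matrix.det_succ_row_zero, Fin.sum_univ_succ, Fin.succAbove]
  ring

theorem det4_rotate (w a b c : Fin 4 → ℝ) : det4 w a b c = - det4 a b c w := by
  simp [det4, Matrix.det_succ_row_zero, Fin.sum_univ_succ, Fin.succAbove]
  ring

/-- Product rule for a vanishing pairing of two vector-valued maps. -/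
theorem dot4_fderiv_of_dot4_eq_zero {g h : ℝ × ℝ → Fin 4 → ℝ}
    (hg : Differentiable ℝ g) (hh : Differentiable ℝ h)
    (hgh : ∀ p, dot4 (g p) (h p) = 0) (p v : ℝ × ℝ) :
    dot4 (fderiv ℝ g p v) (h p) + dot4 (g p) (fderiv ℝ h p v) = 0 := by
  have hg' := hasFDerivAt_pi'.1 (hg p).hasFDerivAt
  have hh' := hasFDerivAt_pi'.1 (hh p).hasFDerivAt
  have hd := HasFDerivAt.fun_sum (u := Finset.univ) fun i _ => (hg' i).mul (hh' i)
  have hz : HasFDerivAt (fun q => ∑ i, g q i * h q i) (0 : ℝ × ℝ →L[ℝ] ℝ) p := by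
    have : (fun q => ∑ i, g q i * h q i) = fun _ => (0 : ℝ) := funext hgh
    rw [this]
    exact hasFDerivAt_const 0 p
  have he := congrArg (fun L : ℝ × ℝ →L[ℝ] ℝ => L v) (hd.unique hz)
  simp only [dot4, ← Finset.sum_add_distrib]
  simpa [mul_comm, add_comm] using he

theorem stmt9 (f ν : ℝ × ℝ → Fin 4 → ℝ)
    (hsf : ContDiff ℝ (⊤ : ℕ∞) f) (hsν : ContDiff ℝ (⊤ : ℕ∞) ν)
    (hpair : ∀ p, dot4 (f p) (ν p) = 0)
    (hLx : ∀ p, ∀ w z : Fin 4 → ℝ,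
      dot4 w (f p) * dot4 z (dx f p) - dot4 z (f p) * dot4 w (dx f p)
        = - det4 w z (ν p) (dy ν p))
    (hLy : ∀ p, ∀ w z : Fin 4 → ℝ,
      dot4 w (f p) * dot4 z (dy f p) - dot4 z (f p) * dot4 w (dy f p)
        = det4 w z (ν p) (dx ν p))
    (hf0 : ∀ p, f p ≠ 0)
    (tr : (Fin 4 → ℝ) → (Fin 4 → ℝ) → (Fin 4 → ℝ) → (Fin 4 → ℝ))
    (htr : ∀ w a b c : Fin 4 → ℝ, dot4 w (tr a b c) = det4 w a b c) :
    (∀ p : ℝ × ℝ,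
      det4 (ν p) (dx ν p) (dy ν p) (dx (dx ν) p)
        = det4 (ν p) (dx ν p) (dy ν p) (dy (dy ν) p)) ∧
    (∀ p : ℝ × ℝ,
      0 < det4 (ν p) (dx ν p) (dy ν p) (dx (dx ν) p) →
      0 < dot4 (dx f p) (dx ν p) →
      f p = (Real.sqrt (det4 (ν p) (dx ν p) (dy ν p) (dx (dx ν) p)))⁻¹ •
          tr (ν p) (dx ν p) (dy ν p) ∧
      f p = (Real.sqrt (det4 (ν p) (dx ν p) (dy ν p) (dy (dy ν) p)))⁻¹ •
          tr (ν p) (dx ν p) (dy ν p)) := by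
  have hdf : Differentiable ℝ f := hsf.differentiable (by simp)
  have hdν : Differentiable ℝ ν := hsν.differentiable (by simp)
  have hdν' : Differentiable ℝ (fderiv ℝ ν) :=
    ((contDiff_infty_iff_fderiv.1 hsν).2).differentiable (by simp)
  have hdx : Differentiable ℝ (dx ν) := hdν'.clm_apply (differentiable_const _)
  have hdy : Differentiable ℝ (dy ν) := hdν'.clm_apply (differentiable_const _)
  have hff : ∀ p, dot4 (f p) (f p) ≠ 0 := fun p => dot4_self_ne_zero (hf0 p)
  have hνf : ∀ p, dot4 (ν p) (f p) = 0 := fun p => (dot4_comm _ _).trans (hpair p)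
  have hfxν : ∀ p, dot4 (dx f p) (ν p) = 0 := fun p => by
    have h := hLx p (f p) (ν p)
    rw [hνf, det4_eq_zero_of_two_eq_three, zero_mul, sub_zero, neg_zero] at h
    exact (dot4_comm _ _).trans ((mul_eq_zero.1 h).resolve_left (hff p))
  have hfyν : ∀ p, dot4 (dy f p) (ν p) = 0 := fun p => by
    have h := hLy p (f p) (ν p)
    rw [hνf, det4_eq_zero_of_two_eq_three, zero_mul, sub_zero] at h
    exact (dot4_comm _ _).trans ((mul_eq_zero.1 h).resolve_left (hff p))
  have hfνx : ∀ p, dot4 (f p) (dx ν p) = 0 := fun p => by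
    have h : dot4 (dx f p) (ν p) + dot4 (f p) (dx ν p) = 0 :=
      dot4_fderiv_of_dot4_eq_zero hdf hdν hpair p (1, 0)
    rwa [hfxν, zero_add] at h
  have hfνy : ∀ p, dot4 (f p) (dy ν p) = 0 := fun p => by
    have h : dot4 (dy f p) (ν p) + dot4 (f p) (dy ν p) = 0 :=
      dot4_fderiv_of_dot4_eq_zero hdf hdν hpair p (0, 1)
    rwa [hfyν, zero_add] at h
  have hwx : ∀ p w, dot4 w (f p) * dot4 (dx f p) (dx ν p) =
      det4 w (ν p) (dx ν p) (dy ν p) := fun p w => by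
    have h := hLx p w (dx ν p)
    rwa [det4_swap, neg_neg, dot4_comm (dx ν p) (f p), hfνx, zero_mul, sub_zero,
      dot4_comm (dx ν p)] at h
  have hwy : ∀ p w, dot4 w (f p) * dot4 (dy f p) (dy ν p) =
      det4 w (ν p) (dx ν p) (dy ν p) := fun p w => by
    have h := hLy p w (dy ν p)
    rwa [det4_rotate_last, dot4_comm (dy ν p) (f p), hfνy, zero_mul, sub_zero,
      dot4_comm (dy ν p)] at h
  have hxy : ∀ p, dot4 (dy f p) (dy ν p) = dot4 (dx f p) (dx ν p) := fun p =>
    mul_left_cancel₀ (hff p) ((hwy p (f p)).trans (hwx p (f p)).symm)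
  have hxx : ∀ p, det4 (ν p) (dx ν p) (dy ν p) (dx (dx ν) p) =
      dot4 (dx f p) (dx ν p) ^ 2 := fun p => by
    have h : dot4 (dx f p) (dx ν p) + dot4 (f p) (dx (dx ν) p) = 0 :=
      dot4_fderiv_of_dot4_eq_zero hdf hdx hfνx p (1, 0)
    have h' := hwx p (dx (dx ν) p)
    rw [det4_rotate, dot4_comm _ (f p)] at h'
    linear_combination h' - dot4 (dx f p) (dx ν p) * h
  have hyy : ∀ p, det4 (ν p) (dx ν p) (dy ν p) (dy (dy ν) p) =
      dot4 (dx f p) (dx ν p) ^ 2 := fun p => by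
    have h : dot4 (dy f p) (dy ν p) + dot4 (f p) (dy (dy ν) p) = 0 :=
      dot4_fderiv_of_dot4_eq_zero hdf hdy hfνy p (0, 1)
    have h' := hwx p (dy (dy ν) p)
    rw [det4_rotate, dot4_comm _ (f p)] at h'
    rw [hxy] at h
    linear_combination h' - dot4 (dx f p) (dx ν p) * h
  refine ⟨fun p => (hxx p).trans (hyy p).symm, fun p _ ha => ?_⟩
  rw [hxx, hyy, Real.sqrt_sq ha.le, and_self]
  funext i
  have h := (hwx p (Pi.single i 1)).trans (htr _ _ _ _).symm
  rw [dot4_single, dot4_single] at h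
  rw [Pi.smul_apply, smul_eq_mul, ← h]
  field_simp
end
end
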